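/- arXiv:1909.08699 — 4 statements merged into one kernel-verified Lean document; each statement's English description precedes it below -/
import Mathlib

section
/- Let ℤ/2 act on the 2-torus T² = (ℝ/ℤ) × (ℝ/ℤ) with the nontrivial element acting by negation x ↦ −x. The orbit space T²/(ℤ/2), equipped with the quotient topology, is homeomorphic to the 2-sphere S² = {v ∈ ℝ³ : ‖v‖ = 1} (the underlying space of the pillowcase orbifold). -/
/-- The even function `(θ, φ) ↦ (cos θ, cos φ, sin θ sin φ)` on the torus, as a map to `ℝ³`. -/
noncomputable def pillowcaseVector (v : AddCircle (1 : ℝ) × AddCircle (1 : ℝ)) :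
    EuclideanSpace ℝ (Fin 3) :=
  !₂[(v.1.toCircle : ℂ).re, (v.2.toCircle : ℂ).re,
    (v.1.toCircle : ℂ).im * (v.2.toCircle : ℂ).im]

theorem circle_re_sq_add_im_sq (z : Circle) : (z : ℂ).re ^ 2 + (z : ℂ).im ^ 2 = 1 := by
  have h := Circle.normSq_coe z
  rw [Complex.normSq_apply] at h
  linarith

theorem norm_pillowcaseVector_sq (v : AddCircle (1 : ℝ) × AddCircle (1 : ℝ)) :
    ‖pillowcaseVector v‖ ^ 2 =
      1 + ((v.1.toCircle : ℂ).re * (v.2.toCircle : ℂ).re) ^ 2 := by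
  have h₁ := circle_re_sq_add_im_sq v.1.toCircle
  have h₂ := circle_re_sq_add_im_sq v.2.toCircle
  simp only [EuclideanSpace.norm_sq_eq, pillowcaseVector, Fin.sum_univ_three, Real.norm_eq_abs,
    sq_abs, Matrix.cons_val]
  rw [← eq_sub_iff_add_eq'] at h₁ h₂
  rw [mul_pow, h₁, h₂]
  ring

theorem norm_pillowcaseVector_pos (v : AddCircle (1 : ℝ) × AddCircle (1 : ℝ)) :
    0 < ‖pillowcaseVector v‖ := by
  refine (norm_nonneg _).lt_of_ne' fun h => ?_
  have := norm_pillowcaseVector_sq v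
  rw [h] at this
  nlinarith [sq_nonneg ((v.1.toCircle : ℂ).re * (v.2.toCircle : ℂ).re)]

theorem continuous_pillowcaseVector : Continuous pillowcaseVector := by
  have h : Continuous fun x : AddCircle (1 : ℝ) => (x.toCircle : ℂ) :=
    continuous_subtype_val.comp AddCircle.continuous_toCircle
  have h₁ := h.comp (continuous_fst (X := AddCircle (1 : ℝ)) (Y := AddCircle (1 : ℝ)))
  have h₂ := h.comp (continuous_snd (X := AddCircle (1 : ℝ)) (Y := AddCircle (1 : ℝ)))
  refine (PiLp.continuous_toLp 2 _).comp (continuous_pi fun i => ?_)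
  fin_cases i
  · exact Complex.continuous_re.comp h₁
  · exact Complex.continuous_re.comp h₂
  · exact (Complex.continuous_im.comp h₁).mul (Complex.continuous_im.comp h₂)

theorem addCircle_ext_re_im {x y : AddCircle (1 : ℝ)}
    (hre : (x.toCircle : ℂ).re = (y.toCircle : ℂ).re)
    (him : (x.toCircle : ℂ).im = (y.toCircle : ℂ).im) : x = y :=
  AddCircle.injective_toCircle one_ne_zero (Circle.ext (Complex.ext hre him))

theorem re_toCircle_neg (x : AddCircle (1 : ℝ)) :
    ((-x).toCircle : ℂ).re = (x.toCircle : ℂ).re := by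
  rw [AddCircle.toCircle_neg, Circle.coe_inv_eq_conj, Complex.conj_re]

theorem im_toCircle_neg (x : AddCircle (1 : ℝ)) :
    ((-x).toCircle : ℂ).im = -(x.toCircle : ℂ).im := by
  rw [AddCircle.toCircle_neg, Circle.coe_inv_eq_conj, Complex.conj_im]

theorem exists_addCircle_re_im {x y : ℝ} (h : x ^ 2 + y ^ 2 = 1) :
    ∃ t : AddCircle (1 : ℝ), (t.toCircle : ℂ).re = x ∧ (t.toCircle : ℂ).im = y := by
  have hz : (⟨x, y⟩ : ℂ) ∈ Submonoid.unitSphere ℂ := by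
    refine mem_sphere_zero_iff_norm.mpr ?_
    rw [← sq_eq_sq₀ (norm_nonneg _) zero_le_one, Complex.sq_norm, Complex.normSq_apply]
    linarith
  obtain ⟨t, ht⟩ := (AddCircle.homeomorphCircle (T := (1 : ℝ)) one_ne_zero).surjective ⟨_, hz⟩
  rw [AddCircle.homeomorphCircle_apply] at ht
  exact ⟨t, by rw [ht], by rw [ht]⟩

theorem pillowcaseVector_neg (v : AddCircle (1 : ℝ) × AddCircle (1 : ℝ)) :
    pillowcaseVector (-v) = pillowcaseVector v := by
  simp only [pillowcaseVector, Prod.fst_neg, Prod.snd_neg, re_toCircle_neg, im_toCircle_neg,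
    neg_mul_neg]

theorem eq_or_eq_neg_of_pillowcaseVector_eq {v w : AddCircle (1 : ℝ) × AddCircle (1 : ℝ)}
    (h : pillowcaseVector v = pillowcaseVector w) : w = v ∨ w = -v := by
  have hx : (v.1.toCircle : ℂ).re = (w.1.toCircle : ℂ).re := congrArg (fun u => u 0) h
  have hy : (v.2.toCircle : ℂ).re = (w.2.toCircle : ℂ).re := congrArg (fun u => u 1) h
  have hz : (v.1.toCircle : ℂ).im * (v.2.toCircle : ℂ).im =
      (w.1.toCircle : ℂ).im * (w.2.toCircle : ℂ).im := congrArg (fun u => u 2) h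
  have h₁ : (w.1.toCircle : ℂ).im = (v.1.toCircle : ℂ).im ∨
      (w.1.toCircle : ℂ).im = -(v.1.toCircle : ℂ).im := by
    rw [← sq_eq_sq_iff_eq_or_eq_neg]
    have hv := circle_re_sq_add_im_sq v.1.toCircle
    have hw := circle_re_sq_add_im_sq w.1.toCircle
    rw [hx] at hv
    linarith
  have h₂ : (w.2.toCircle : ℂ).im = (v.2.toCircle : ℂ).im ∨
      (w.2.toCircle : ℂ).im = -(v.2.toCircle : ℂ).im := by
    rw [← sq_eq_sq_iff_eq_or_eq_neg]
    have hv := circle_re_sq_add_im_sq v.2.toCircle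
    have hw := circle_re_sq_add_im_sq w.2.toCircle
    rw [hy] at hv
    linarith
  have key : ((w.1.toCircle : ℂ).im = (v.1.toCircle : ℂ).im ∧
        (w.2.toCircle : ℂ).im = (v.2.toCircle : ℂ).im) ∨
      ((w.1.toCircle : ℂ).im = -(v.1.toCircle : ℂ).im ∧
        (w.2.toCircle : ℂ).im = -(v.2.toCircle : ℂ).im) := by
    generalize (v.1.toCircle : ℂ).im = a at *
    generalize (v.2.toCircle : ℂ).im = b at *
    generalize (w.1.toCircle : ℂ).im = c at *
    generalize (w.2.toCircle : ℂ).im = d at *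
    by_cases ha : a = 0
    · grind
    · by_cases hb : b = 0
      · grind
      · grind
  refine key.imp (fun k => ?_) (fun k => ?_)
  · exact Prod.ext (addCircle_ext_re_im hx.symm k.1) (addCircle_ext_re_im hy.symm k.2)
  · exact Prod.ext
      (addCircle_ext_re_im (hx.symm.trans (re_toCircle_neg _).symm)
        (k.1.trans (im_toCircle_neg _).symm))
      (addCircle_ext_re_im (hy.symm.trans (re_toCircle_neg _).symm)
        (k.2.trans (im_toCircle_neg _).symm))

/-- The radial projection of `pillowcaseVector` to the unit sphere. -/
noncomputable def pillowcaseMap (v : AddCircle (1 : ℝ) × AddCircle (1 : ℝ)) :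
    Metric.sphere (0 : EuclideanSpace ℝ (Fin 3)) 1 :=
  ⟨‖pillowcaseVector v‖⁻¹ • pillowcaseVector v, by
    rw [mem_sphere_zero_iff_norm, norm_smul, norm_inv, norm_norm,
      inv_mul_cancel₀ (norm_pillowcaseVector_pos v).ne']⟩

theorem continuous_pillowcaseMap : Continuous pillowcaseMap :=
  ((continuous_pillowcaseVector.norm.inv₀ fun v => (norm_pillowcaseVector_pos v).ne').smul
    continuous_pillowcaseVector).subtype_mk _

theorem eq_of_mul_one_add_sq_eq {p q : ℝ} (hp : p ^ 2 ≤ 1) (hq : q ^ 2 ≤ 1)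
    (h : p * (1 + q ^ 2) = q * (1 + p ^ 2)) : p = q := by
  have h' : (p - q) * (1 - p * q) = 0 := by linarith
  rcases mul_eq_zero.mp h' with h' | h'
  · linarith
  · nlinarith [sq_nonneg (p - q)]

theorem re_mul_re_sq_le_one (z w : Circle) : ((z : ℂ).re * (w : ℂ).re) ^ 2 ≤ 1 := by
  rw [mul_pow]
  exact mul_le_one₀ (by nlinarith [circle_re_sq_add_im_sq z, sq_nonneg (z : ℂ).im])
    (sq_nonneg _) (by nlinarith [circle_re_sq_add_im_sq w, sq_nonneg (w : ℂ).im])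

theorem pillowcaseMap_eq_iff {v w : AddCircle (1 : ℝ) × AddCircle (1 : ℝ)} :
    pillowcaseMap v = pillowcaseMap w ↔ w = v ∨ w = -v := by
  constructor
  · intro h
    apply eq_or_eq_neg_of_pillowcaseVector_eq
    have hv : ‖pillowcaseVector v‖⁻¹ • pillowcaseVector v =
        ‖pillowcaseVector w‖⁻¹ • pillowcaseVector w := congrArg Subtype.val h
    suffices hn : ‖pillowcaseVector v‖ = ‖pillowcaseVector w‖ by
      rw [hn] at hv
      exact smul_right_injective _ (inv_ne_zero (norm_pillowcaseVector_pos w).ne') hv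
    have hx : ‖pillowcaseVector v‖⁻¹ * (v.1.toCircle : ℂ).re =
        ‖pillowcaseVector w‖⁻¹ * (w.1.toCircle : ℂ).re := congrArg (fun u => u 0) hv
    have hy : ‖pillowcaseVector v‖⁻¹ * (v.2.toCircle : ℂ).re =
        ‖pillowcaseVector w‖⁻¹ * (w.2.toCircle : ℂ).re := congrArg (fun u => u 1) hv
    have nv := norm_pillowcaseVector_sq v
    have nw := norm_pillowcaseVector_sq w
    have pv := norm_pillowcaseVector_pos v
    have pw := norm_pillowcaseVector_pos w
    have hq : (v.1.toCircle : ℂ).re * (v.2.toCircle : ℂ).re =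
        (w.1.toCircle : ℂ).re * (w.2.toCircle : ℂ).re := by
      refine eq_of_mul_one_add_sq_eq (re_mul_re_sq_le_one _ _) (re_mul_re_sq_le_one _ _) ?_
      rw [← nv, ← nw]
      have hxy := congrArg₂ (· * ·) hx hy
      field_simp at hxy
      linarith
    rw [← sq_eq_sq₀ pv.le pw.le, nv, nw, hq]
  · rintro (rfl | rfl)
    · rfl
    · simp only [pillowcaseMap, pillowcaseVector_neg]

/-- A unit vector can be rescaled to the surface `z² = (1 - x²)(1 - y²)`. -/
theorem exists_scale_to_pillowcase {a b c : ℝ} (h : a ^ 2 + b ^ 2 + c ^ 2 = 1) :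
    ∃ t : ℝ, 0 < t ∧ (t * a) ^ 2 ≤ 1 ∧ (t * b) ^ 2 ≤ 1 ∧
      (t * c) ^ 2 = (1 - (t * a) ^ 2) * (1 - (t * b) ^ 2) := by
  have hd : 0 ≤ 1 - 4 * (a ^ 2 * b ^ 2) := by
    nlinarith [sq_nonneg (a ^ 2 - b ^ 2), sq_nonneg c, sq_nonneg a, sq_nonneg b]
  set s := √(1 - 4 * (a ^ 2 * b ^ 2)) with hs
  have hs0 : 0 ≤ s := Real.sqrt_nonneg _
  have hs2 : s ^ 2 = 1 - 4 * (a ^ 2 * b ^ 2) := Real.sq_sqrt hd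
  have scaled_le : ∀ {x y : ℝ}, x ^ 2 + y ^ 2 ≤ 1 → s ^ 2 = 1 - 4 * (x ^ 2 * y ^ 2) →
      2 / (1 + s) * x ^ 2 ≤ 1 := by
    intro x y hxy hsxy
    rw [div_mul_eq_mul_div, div_le_one (by positivity)]
    have : 2 * x ^ 2 - 1 ≤ s := by
      apply le_of_sq_le_sq _ hs0
      nlinarith [mul_nonneg (sq_nonneg x) (sub_nonneg.mpr hxy)]
    linarith
  have ht : √(2 / (1 + s)) ^ 2 = 2 / (1 + s) := Real.sq_sqrt (by positivity)
  refine ⟨√(2 / (1 + s)), Real.sqrt_pos.mpr (by positivity), ?_, ?_, ?_⟩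
  · rw [mul_pow, ht]
    exact scaled_le (y := b) (by nlinarith [sq_nonneg c]) hs2
  · rw [mul_pow, ht]
    exact scaled_le (y := a) (by nlinarith [sq_nonneg c]) (by linarith)
  · simp only [mul_pow, ht]
    have hc : c ^ 2 = 1 - a ^ 2 - b ^ 2 := by linarith
    have hs1 : 1 + s ≠ 0 := by positivity
    rw [hc]
    field_simp
    linear_combination -hs2

theorem exists_pillowcaseVector_eq {x y z : ℝ} (hx : x ^ 2 ≤ 1) (hy : y ^ 2 ≤ 1)
    (h : z ^ 2 = (1 - x ^ 2) * (1 - y ^ 2)) : ∃ v, pillowcaseVector v = !₂[x, y, z] := by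
  have hx' : √(1 - x ^ 2) ^ 2 = 1 - x ^ 2 := Real.sq_sqrt (by linarith)
  have hy' : √(1 - y ^ 2) ^ 2 = 1 - y ^ 2 := Real.sq_sqrt (by linarith)
  obtain ⟨r, hr, hz⟩ : ∃ r : ℝ, y ^ 2 + r ^ 2 = 1 ∧ √(1 - x ^ 2) * r = z := by
    have : z ^ 2 = (√(1 - x ^ 2) * √(1 - y ^ 2)) ^ 2 := by rw [mul_pow, hx', hy', h]
    rcases sq_eq_sq_iff_eq_or_eq_neg.mp this with hz | hz
    · exact ⟨√(1 - y ^ 2), by linarith, hz.symm⟩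
    · exact ⟨-√(1 - y ^ 2), by rw [neg_sq]; linarith, by rw [hz, mul_neg]⟩
  obtain ⟨p, hp, hp'⟩ := exists_addCircle_re_im (x := x) (y := √(1 - x ^ 2)) (by linarith)
  obtain ⟨q, hq, hq'⟩ := exists_addCircle_re_im hr
  exact ⟨(p, q), by simp only [pillowcaseVector, hp, hp', hq, hq', hz]⟩

theorem surjective_pillowcaseMap : Function.Surjective pillowcaseMap := by
  rintro ⟨u, hu⟩
  have hn : ‖u‖ = 1 := mem_sphere_zero_iff_norm.mp hu
  have hsum : u 0 ^ 2 + u 1 ^ 2 + u 2 ^ 2 = 1 := by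
    have := EuclideanSpace.norm_sq_eq u
    simp only [hn, Fin.sum_univ_three, Real.norm_eq_abs, sq_abs] at this
    linarith
  obtain ⟨t, ht, hx, hy, hz⟩ := exists_scale_to_pillowcase hsum
  obtain ⟨v, hv⟩ := exists_pillowcaseVector_eq hx hy hz
  have hv' : pillowcaseVector v = t • u := by
    rw [hv]
    ext i
    fin_cases i <;> rfl
  refine ⟨v, Subtype.ext ?_⟩
  change ‖pillowcaseVector v‖⁻¹ • pillowcaseVector v = u
  rw [hv', norm_smul, hn, mul_one, Real.norm_of_nonneg ht.le, inv_smul_smul₀ ht.ne']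

/-- Let `ℤ/2` act on the 2-torus `T² = (ℝ/ℤ) × (ℝ/ℤ)` with the nontrivial
element acting by negation `x ↦ -x`.  The orbit space `T²/(ℤ/2)` (quotient by the orbit
relation `w = v ∨ w = -v`, with the quotient topology) is homeomorphic to the 2-sphere
`S² = {v ∈ ℝ³ : ‖v‖ = 1}` — the underlying space of the pillowcase orbifold. -/
theorem orbitSpace_pillowcase_homeomorph_sphere :
    Nonempty
      (Quot (fun v w : AddCircle (1 : ℝ) × AddCircle (1 : ℝ) => w = v ∨ w = -v) ≃ₜ
        Metric.sphere (0 : EuclideanSpace ℝ (Fin 3)) 1) := by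
  have : Fact ((0 : ℝ) < 1) := ⟨one_pos⟩
  let f : Quot (fun v w : AddCircle (1 : ℝ) × AddCircle (1 : ℝ) => w = v ∨ w = -v) →
      Metric.sphere (0 : EuclideanSpace ℝ (Fin 3)) 1 :=
    Quot.lift pillowcaseMap fun _ _ h => pillowcaseMap_eq_iff.mpr h
  have hf : Continuous f := continuous_quot_lift _ continuous_pillowcaseMap
  have hinj : Function.Injective f := by
    rintro ⟨v⟩ ⟨w⟩ h
    exact Quot.sound (pillowcaseMap_eq_iff.mp h)
  have hsurj : Function.Surjective f := fun u =>
    (surjective_pillowcaseMap u).imp' (Quot.mk _) fun _ h => h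
  exact ⟨Continuous.homeoOfEquivCompactToT2 (f := Equiv.ofBijective f ⟨hinj, hsurj⟩) hf⟩
end

section
/- Let ℤ/2 act on ℝ³ with the nontrivial element acting by the antipodal map v ↦ −v, let Q = ℝ³/(ℤ/2) be the orbit space with the quotient topology, and let q₀ ∈ Q be the image of the origin. Then no open neighborhood of q₀ in Q is homeomorphic to an open subset of ℝ³. In particular, Q is not a topological 3-manifold, even though Q is the underlying space of a smooth orbifold. -/
open Topology

/-- The relation identifying antipodal points of `ℝ³`. -/
abbrev AntipodalRel (v w : EuclideanSpace ℝ (Fin 3)) : Prop := w = v ∨ w = -v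

instance isAddTorsionFree_euclideanSpace_three : IsAddTorsionFree (EuclideanSpace ℝ (Fin 3)) :=
  .of_isTorsionFree ℝ _

theorem mk_antipodalRel_eq_iff {v w : EuclideanSpace ℝ (Fin 3)} :
    Quot.mk AntipodalRel v = Quot.mk AntipodalRel w ↔ w = v ∨ w = -v := by
  have h : Equivalence AntipodalRel := by
    refine ⟨fun x => .inl rfl, ?_, ?_⟩
    · rintro x y (rfl | rfl) <;> simp [AntipodalRel]
    · rintro x y z (rfl | rfl) (rfl | rfl) <;> simp [AntipodalRel]
  exact ⟨fun e => h.quot_mk_eq_iff v w |>.1 e, fun e => Quot.sound e⟩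

theorem isCoveringMapOn_mk_antipodalRel :
    IsCoveringMapOn (Quot.mk AntipodalRel) {Quot.mk AntipodalRel 0}ᶜ := by
  have horb {v w : EuclideanSpace ℝ (Fin 3)} :
      Quot.mk AntipodalRel v = Quot.mk AntipodalRel w ↔ v ∈ MulAction.orbit ℤˣ w := by
    rw [mk_antipodalRel_eq_iff, MulAction.mem_orbit_iff]
    constructor
    · rintro (rfl | rfl)
      · exact ⟨1, one_smul _ _⟩
      · exact ⟨-1, by simp [Units.smul_def]⟩
    · rintro ⟨g, rfl⟩
      rcases Int.units_eq_one_or g with rfl | rfl <;> simp [Units.smul_def]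
  have : ContinuousConstSMul ℤˣ (EuclideanSpace ℝ (Fin 3)) :=
    ⟨fun g => by simpa only [Units.smul_def] using continuous_const_smul (g : ℤ)⟩
  refine (isQuotientMap_quot_mk.isCoveringMapOn_of_properlyDiscontinuousSMul horb).mono ?_
  intro q hq
  obtain ⟨v, rfl⟩ := Quot.exists_rep q
  refine ⟨v, (Subgroup.eq_bot_iff_forall _).2 fun g hg => ?_, rfl⟩
  have hv : v ≠ 0 := fun h => hq (by rw [h]; rfl)
  rcases Int.units_eq_one_or g with rfl | rfl
  · rfl
  · have : -v = v := by simpa [Units.smul_def, MulAction.mem_stabilizer_iff] using hg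
    exact absurd (self_eq_neg.1 this.symm) hv

/-- Two continuous nonvanishing maps on a preconnected set which agree pointwise up to sign
agree up to a global sign. -/
theorem IsPreconnected.eqOn_or_eqOn_neg {X E : Type*} [TopologicalSpace X] [NormedAddCommGroup E]
    [InnerProductSpace ℝ E] {S : Set X} (hS : IsPreconnected S) {g₁ g₂ : X → E}
    (h₁ : ContinuousOn g₁ S) (h₂ : ContinuousOn g₂ S) (h0 : ∀ x ∈ S, g₁ x ≠ 0)
    (h : ∀ x ∈ S, g₂ x = g₁ x ∨ g₂ x = -g₁ x) :
    Set.EqOn g₂ g₁ S ∨ Set.EqOn g₂ (-g₁) S := by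
  by_contra! hcon
  simp only [Set.EqOn, not_forall] at hcon
  obtain ⟨⟨x, hx, hx'⟩, y, hy, hy'⟩ := hcon
  have ex := (h x hx).resolve_left hx'
  have ey := (h y hy).resolve_right hy'
  have hc : ContinuousOn (fun z => inner ℝ (g₁ z) (g₂ z)) S := h₁.inner h₂
  have hpx : inner ℝ (g₁ x) (g₂ x) < 0 := by
    rw [ex, inner_neg_right, neg_lt_zero]; exact real_inner_self_pos.2 (h0 x hx)
  have hpy : 0 < inner ℝ (g₁ y) (g₂ y) := by
    rw [ey]; exact real_inner_self_pos.2 (h0 y hy)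
  obtain ⟨z, hz, hz'⟩ := hS.intermediate_value hx hy hc ⟨hpx.le, hpy.le⟩
  rcases h z hz with e | e <;> simp [e, h0 z hz] at hz'

/-- The complement in `ℝ³` of the closed ray from the origin through `s • e₀`. -/
def rayCompl (s : ℝ) : Set (EuclideanSpace ℝ (Fin 3)) :=
  {v | v 1 ≠ 0 ∨ v 2 ≠ 0 ∨ s * v 0 < 0}

theorem isOpen_rayCompl (s : ℝ) : IsOpen (rayCompl s) := by
  have h (i : Fin 3) : IsOpen {v : EuclideanSpace ℝ (Fin 3) | v i ≠ 0} :=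
    isOpen_ne_fun (by fun_prop) (by fun_prop)
  have h' : IsOpen {v : EuclideanSpace ℝ (Fin 3) | s * v 0 < 0} :=
    isOpen_lt (by fun_prop) (by fun_prop)
  exact (h 1).union ((h 2).union h')

theorem starConvex_rayCompl {s : ℝ} (hs : s ≠ 0) :
    StarConvex ℝ (EuclideanSpace.single 0 (-s)) (rayCompl s) := by
  intro v hv a b ha hb hab
  have hss : 0 < s * s := mul_self_pos.2 hs
  rcases hb.eq_or_lt with rfl | hb
  · obtain rfl : a = 1 := by linarith
    right; right
    simp; positivity
  · rcases hv with h | h | h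
    · left; simp [h, hb.ne']
    · right; left; simp [h, hb.ne']
    · right; right
      simp only [PiLp.add_apply, PiLp.smul_apply, PiLp.single_apply, smul_eq_mul, if_true]
      nlinarith [mul_pos_of_neg_of_neg h (neg_lt_zero.2 hb), mul_nonneg ha hss.le]

theorem contractibleSpace_rayCompl {s : ℝ} (hs : s ≠ 0) : ContractibleSpace (rayCompl s) := by
  refine (starConvex_rayCompl hs).contractibleSpace ⟨EuclideanSpace.single 1 1, ?_⟩
  left; simp

theorem zero_notMem_rayCompl (s : ℝ) : 0 ∉ rayCompl s := by
  simp [rayCompl]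

theorem rayCompl_inter : rayCompl 1 ∩ rayCompl (-1) = {v | v 1 ≠ 0 ∨ v 2 ≠ 0} := by
  ext v
  simp only [rayCompl, Set.mem_inter_iff, Set.mem_ofPred_eq]
  constructor
  · rintro ⟨h | h | h, h' | h' | h'⟩ <;> first | tauto | (exfalso; linarith)
  · tauto

theorem rayCompl_union : rayCompl 1 ∪ rayCompl (-1) = {0}ᶜ := by
  ext v
  simp only [rayCompl, Set.mem_union, Set.mem_ofPred_eq, Set.mem_compl_iff, Set.mem_singleton_iff]
  constructor
  · rintro h rfl
    simp at h
  · intro h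
    by_contra! hc
    obtain ⟨⟨h1, h2, h3⟩, -, -, h4⟩ := hc
    apply h
    ext i
    fin_cases i
    · simp; linarith
    · simpa using h1
    · simpa using h2

theorem isPreconnected_rayCompl_inter : IsPreconnected (rayCompl 1 ∩ rayCompl (-1)) := by
  have hpos (i : Fin 3) : IsPreconnected {v : EuclideanSpace ℝ (Fin 3) | 0 < v i} :=
    (convex_halfSpace_gt (EuclideanSpace.proj (𝕜 := ℝ) i).isLinear 0).isPreconnected
  have hneg (i : Fin 3) : IsPreconnected {v : EuclideanSpace ℝ (Fin 3) | v i < 0} :=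
    (convex_halfSpace_lt (EuclideanSpace.proj (𝕜 := ℝ) i).isLinear 0).isPreconnected
  have key := ((hpos 1).union (!₂[0, 1, 1] : EuclideanSpace ℝ (Fin 3)) (by simp) (by simp)
    (hpos 2)).union (!₂[0, 1, -1] : EuclideanSpace ℝ (Fin 3)) (by simp) (by simp)
    ((hneg 2).union (!₂[0, -1, -1] : EuclideanSpace ℝ (Fin 3)) (by simp) (by simp) (hneg 1))
  rw [rayCompl_inter]
  convert key using 1
  ext v
  simp only [Set.mem_ofPred_eq, Set.mem_union, ne_iff_lt_or_gt]
  tauto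

theorem exists_lift_rayCompl {f : EuclideanSpace ℝ (Fin 3) → Quot AntipodalRel}
    (hf : Continuous f) (hf0 : ∀ v ≠ 0, f v ≠ Quot.mk AntipodalRel 0) {s : ℝ} (hs : s ≠ 0)
    {a e : EuclideanSpace ℝ (Fin 3)} (ha : a ∈ rayCompl s) (he : Quot.mk AntipodalRel e = f a) :
    ∃ F : EuclideanSpace ℝ (Fin 3) → EuclideanSpace ℝ (Fin 3), ContinuousOn F (rayCompl s) ∧
      F a = e ∧ ∀ v ∈ rayCompl s, Quot.mk AntipodalRel (F v) = f v := by
  have := contractibleSpace_rayCompl hs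
  have := (isOpen_rayCompl s).locallyPathConnectedSpace
  obtain ⟨F, ⟨hFa, hF⟩, -⟩ :=
    isCoveringMapOn_mk_antipodalRel.existsUnique_continuousMap_lifts
      (A := rayCompl s) ⟨fun v => f v, by fun_prop⟩ (a₀ := ⟨a, ha⟩) (e₀ := e) he
      (fun v => hf0 v fun h => zero_notMem_rayCompl s (h ▸ v.2))
  classical
  refine ⟨fun v => if h : v ∈ rayCompl s then F ⟨v, h⟩ else 0, ?_, by simp [ha, hFa], ?_⟩
  · rw [continuousOn_iff_continuous_domRestrict]
    convert! F.continuous using 1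
    ext1 v
    simp
  · intro v hv
    simpa [hv] using congrFun hF ⟨v, hv⟩

/-- A map from `ℝ³` to the antipodal quotient avoiding the vertex away from the origin lifts to
`ℝ³` on the complement of the origin. -/
theorem exists_lift_compl_zero {f : EuclideanSpace ℝ (Fin 3) → Quot AntipodalRel}
    (hf : Continuous f) (hf0 : ∀ v ≠ 0, f v ≠ Quot.mk AntipodalRel 0) :
    ∃ F : EuclideanSpace ℝ (Fin 3) → EuclideanSpace ℝ (Fin 3), ContinuousOn F {0}ᶜ ∧
      ∀ v ≠ 0, Quot.mk AntipodalRel (F v) = f v := by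
  classical
  set a : EuclideanSpace ℝ (Fin 3) := EuclideanSpace.single 1 1
  have ha (s : ℝ) : a ∈ rayCompl s := by left; simp [a]
  obtain ⟨e, he⟩ := Quot.exists_rep (f a)
  obtain ⟨F, hFc, hFa, hF⟩ := exists_lift_rayCompl hf hf0 one_ne_zero (ha 1) he
  obtain ⟨G, hGc, hGa, hG⟩ := exists_lift_rayCompl hf hf0 (neg_ne_zero.2 one_ne_zero) (ha (-1)) he
  have hF0 (v) (hv : v ∈ rayCompl 1) : F v ≠ 0 := fun h =>
    hf0 v (fun h => zero_notMem_rayCompl 1 (h ▸ hv)) (by rw [← hF v hv, h])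
  have hFG : Set.EqOn G F (rayCompl 1 ∩ rayCompl (-1)) := by
    refine (isPreconnected_rayCompl_inter.eqOn_or_eqOn_neg (hFc.mono Set.inter_subset_left)
      (hGc.mono Set.inter_subset_right) (fun v hv => hF0 v hv.1) fun v hv =>
        mk_antipodalRel_eq_iff.1 ((hF v hv.1).trans (hG v hv.2).symm)).resolve_right fun h => ?_
    have h' := h ⟨ha 1, ha (-1)⟩
    rw [Pi.neg_apply, hFa, hGa] at h'
    exact hF0 a (ha 1) (hFa.trans (self_eq_neg.1 h'))
  refine ⟨(rayCompl 1).piecewise F G, ?_, fun v hv => ?_⟩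
  · have h1 : ContinuousOn ((rayCompl 1).piecewise F G) (rayCompl 1) :=
      hFc.congr (Set.piecewise_eqOn _ _ _)
    have h2 : ContinuousOn ((rayCompl 1).piecewise F G) (rayCompl (-1)) := by
      refine hGc.congr fun v hv => ?_
      by_cases h : v ∈ rayCompl 1
      · simp [h, hFG ⟨h, hv⟩]
      · simp [h]
    rw [← rayCompl_union]
    exact h1.union_of_isOpen h2 (isOpen_rayCompl _) (isOpen_rayCompl _)
  · by_cases h : v ∈ rayCompl 1
    · simp [h, hF v h]
    · have hv' : v ∈ rayCompl 1 ∪ rayCompl (-1) := by rw [rayCompl_union]; exact hv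
      simp [h, hG v (hv'.resolve_left h)]

/-- No open embedding of `ℝ³` in the antipodal quotient hits the vertex at the origin. -/
theorem not_isOpenEmbedding_of_apply_zero
    {f : EuclideanSpace ℝ (Fin 3) → Quot AntipodalRel} (hf : IsOpenEmbedding f)
    (hf0 : f 0 = Quot.mk AntipodalRel 0) : False := by
  obtain ⟨F, hFc, hF⟩ := exists_lift_compl_zero hf.continuous
    fun v hv h => hv (hf.injective (h.trans hf0.symm))
  have hπ : Continuous (Quot.mk AntipodalRel) := continuous_quot_mk
  obtain ⟨ε, hε, hball⟩ := Metric.isOpen_iff.1 (hf.isOpen_range.preimage hπ) 0 ⟨0, hf0⟩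
  set S := Metric.sphere (0 : EuclideanSpace ℝ (Fin 3)) (ε / 2)
  have hSball (v) (hv : v ∈ S) : Quot.mk AntipodalRel v ∈ Set.range f :=
    hball (Metric.sphere_subset_ball (half_lt_self hε) hv)
  have hS0 (v) (hv : v ∈ S) : v ≠ 0 := by
    rintro rfl
    simp [S] at hv
    linarith
  have hS : IsPreconnected S := isPreconnected_sphere
    (by rw [← Module.finrank_eq_rank]; simp) 0 _
  set e := hf.toOpenPartialHomeomorph f
  have hfe (v) (hv : v ∈ S) : f (e.symm (Quot.mk AntipodalRel v)) = Quot.mk AntipodalRel v :=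
    e.right_inv (by simpa [e] using hSball v hv)
  have he0 (v) (hv : v ∈ S) : e.symm (Quot.mk AntipodalRel v) ≠ 0 := fun h => by
    have := hfe v hv
    rw [h, hf0, mk_antipodalRel_eq_iff] at this
    exact hS0 v hv (by simpa using this)
  set g : EuclideanSpace ℝ (Fin 3) → EuclideanSpace ℝ (Fin 3) :=
    fun v => F (e.symm (Quot.mk AntipodalRel v))
  have hgc : ContinuousOn g S :=
    hFc.comp (e.continuousOn_symm.comp hπ.continuousOn fun v hv => by
      simpa [e] using hSball v hv) he0
  have hg (v) (hv : v ∈ S) : g v = v ∨ g v = -v :=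
    mk_antipodalRel_eq_iff.1 (((hF _ (he0 v hv)).trans (hfe v hv)).symm)
  have hgneg (v) : g (-v) = g v := by
    have : Quot.mk AntipodalRel (-v) = Quot.mk AntipodalRel v := by
      simp [mk_antipodalRel_eq_iff]
    simp only [g, this]
  obtain ⟨v, hv⟩ : S.Nonempty := NormedSpace.sphere_nonempty.2 (by positivity)
  have hv' : -v ∈ S := by simpa [S] using hv
  rcases hS.eqOn_or_eqOn_neg continuousOn_id hgc hS0 hg with h | h
  · have h1 := h hv
    have h2 := h hv'
    rw [hgneg, h1] at h2
    exact hS0 v hv (self_eq_neg.1 h2)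
  · have h1 := h hv
    have h2 := h hv'
    rw [hgneg, h1] at h2
    exact hS0 v hv (neg_eq_self.1 (by simpa using h2))


/-- Let `ℤ/2` act on `ℝ³` with the nontrivial element acting by the
antipodal map `v ↦ -v`, let `Q = ℝ³/(ℤ/2)` be the orbit space (quotient by the orbit
relation `w = v ∨ w = -v`, with the quotient topology), and let `q₀ ∈ Q` be the image of
the origin.  Then no open neighborhood of `q₀` in `Q` is homeomorphic to an open subset of
`ℝ³`.  (In particular, `Q` is not a topological 3-manifold, even though it is the underlying
space of a smooth orbifold.) -/
theorem coneOverRP2_not_locally_euclidean_at_vertex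
    (U : Set (Quot (fun v w : EuclideanSpace ℝ (Fin 3) => w = v ∨ w = -v)))
    (hU : IsOpen U)
    (hq₀ : Quot.mk (fun v w : EuclideanSpace ℝ (Fin 3) => w = v ∨ w = -v) 0 ∈ U)
    (V : Set (EuclideanSpace ℝ (Fin 3))) (hV : IsOpen V) :
    ¬ Nonempty (U ≃ₜ V) := by
  rintro ⟨h⟩
  set p : V := h ⟨_, hq₀⟩
  obtain ⟨r, hr, hball⟩ := Metric.isOpen_iff.1 hV p p.2
  set φ := OpenPartialHomeomorph.univBall (p : EuclideanSpace ℝ (Fin 3)) r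
  have hφ : IsOpenEmbedding φ :=
    φ.isOpenEmbedding (OpenPartialHomeomorph.univBall_source _ _)
  have hφV (v) : φ v ∈ V := hball <| by
    rw [← OpenPartialHomeomorph.univBall_target (p : EuclideanSpace ℝ (Fin 3)) hr]
    exact φ.map_source (by simp [φ])
  have hφ' : IsOpenEmbedding fun v => (⟨φ v, hφV v⟩ : V) :=
    .of_comp _ hV.isOpenEmbedding_subtypeVal hφ
  refine not_isOpenEmbedding_of_apply_zero
    (hU.isOpenEmbedding_subtypeVal.comp (h.symm.isOpenEmbedding.comp hφ')) ?_
  have : (⟨φ 0, hφV 0⟩ : V) = p := Subtype.ext (OpenPartialHomeomorph.univBall_apply_zero _ _)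
  simp [this, p]
end

section
/- Let λ₀, …, λ_n be positive integers. Let ℂ^× act on ℂ^{n+1} ∖ {0} by the weighted Hopf action z•(z₀,…,z_n) = (z^{λ₀}z₀, …, z^{λ_n}z_n), and let the circle group 𝕊¹ = {z ∈ ℂ : |z| = 1} act on the unit sphere S^{2n+1} = {w ∈ ℂ^{n+1} : ‖w‖ = 1} by the restriction of this action. Then the inclusion S^{2n+1} ↪ ℂ^{n+1} ∖ {0} descends to a homeomorphism of orbit spaces S^{2n+1}/𝕊¹ ≅ (ℂ^{n+1} ∖ {0})/ℂ^×, both equipped with their quotient topologies. -/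
namespace WeightedHopf

variable {ι : Type*} (lam : ι → ℕ)

/-- The weighted Hopf action `z • (zᵢ)ᵢ = (z ^ lam i * zᵢ)ᵢ`. -/
noncomputable def act (z : ℂ) (v : EuclideanSpace ℂ ι) : EuclideanSpace ℂ ι :=
  WithLp.toLp 2 fun i => z ^ lam i * v i

@[simp]
lemma act_apply (z : ℂ) (v : EuclideanSpace ℂ ι) (i : ι) : act lam z v i = z ^ lam i * v i :=
  rfl

@[simp]
lemma act_one (v : EuclideanSpace ℂ ι) : act lam 1 v = v := by
  ext i
  simp

lemma act_act (z w : ℂ) (v : EuclideanSpace ℂ ι) : act lam z (act lam w v) = act lam (z * w) v := by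
  ext i
  simp [mul_pow, mul_assoc]

lemma continuous_act : Continuous fun p : ℂ × EuclideanSpace ℂ ι => act lam p.1 p.2 := by
  refine (PiLp.continuous_toLp 2 _).comp (continuous_pi fun i => ?_)
  fun_prop

lemma act_ne_zero {z : ℂ} (hz : z ≠ 0) {v : EuclideanSpace ℂ ι} (hv : v ≠ 0) :
    act lam z v ≠ 0 := by
  intro h
  apply hv
  rw [← act_one lam v, ← inv_mul_cancel₀ hz, ← act_act, h]
  ext i
  simp

variable [Fintype ι]

lemma norm_act_norm (z : ℂ) (v : EuclideanSpace ℂ ι) : ‖act lam (‖z‖ : ℂ) v‖ = ‖act lam z v‖ := by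
  simp [EuclideanSpace.norm_eq]

variable {lam}

lemma norm_act_le (hlam : ∀ i, 0 < lam i) {s : ℝ} (hs : 0 ≤ s) (hs1 : s ≤ 1)
    (v : EuclideanSpace ℂ ι) : ‖act lam s v‖ ≤ s * ‖v‖ := by
  have key : ‖act lam s v‖ ≤ ‖s • v‖ := by
    rw [EuclideanSpace.norm_eq, EuclideanSpace.norm_eq]
    refine Real.sqrt_le_sqrt (Finset.sum_le_sum fun i _ => ?_)
    have h : s ^ lam i ≤ s := pow_le_of_le_one hs hs1 (hlam i).ne'
    have : ‖act lam s v i‖ ≤ ‖(s • v) i‖ := by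
      simp only [act_apply, norm_mul, norm_pow, Complex.norm_real, PiLp.smul_apply, norm_smul,
        Real.norm_of_nonneg hs]
      gcongr
    gcongr
  rwa [norm_smul, Real.norm_of_nonneg hs] at key

lemma strictMonoOn_norm_act (hlam : ∀ i, 0 < lam i) {v : EuclideanSpace ℂ ι} (hv : v ≠ 0) :
    StrictMonoOn (fun r : ℝ => ‖act lam r v‖) (Set.Ici 0) := by
  intro a ha b _ hab
  have ha : 0 ≤ a := ha
  have hb : 0 < b := ha.trans_lt hab
  have hpos : 0 < ‖act lam b v‖ :=
    norm_pos_iff.2 (act_ne_zero lam (Complex.ofReal_ne_zero.2 hb.ne') hv)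
  have h := norm_act_le hlam (div_nonneg ha hb.le) ((div_le_one hb).2 hab.le) (act lam b v)
  rw [act_act, ← Complex.ofReal_mul, div_mul_cancel₀ _ hb.ne'] at h
  exact h.trans_lt (mul_lt_of_lt_one_left hpos ((div_lt_one hb).2 hab))

lemma norm_eq_one_of_norm_act (hlam : ∀ i, 0 < lam i) {z : ℂ} {v : EuclideanSpace ℂ ι}
    (hv : ‖v‖ = 1) (hz : ‖act lam z v‖ = 1) : ‖z‖ = 1 := by
  have hv0 : v ≠ 0 := by
    rintro rfl
    simp at hv
  refine (strictMonoOn_norm_act hlam hv0).injOn (norm_nonneg z) (zero_le_one' ℝ) ?_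
  simp [norm_act_norm, hv, hz]

lemma exists_norm_act_eq_one (hlam : ∀ i, 0 < lam i) {v : EuclideanSpace ℂ ι} (hv : v ≠ 0) :
    ∃ r : ℝ, 0 < r ∧ ‖act lam r v‖ = 1 := by
  set R : ℝ := max 1 ‖v‖⁻¹
  have hR1 : 1 ≤ R := le_max_left _ _
  have hR : 0 < R := one_pos.trans_le hR1
  have h0 : ‖act lam (0 : ℝ) v‖ = 0 := by
    simpa using norm_act_le hlam le_rfl zero_le_one v
  have h1 : 1 ≤ ‖act lam R v‖ := by
    have h := norm_act_le hlam (inv_nonneg.2 hR.le) (inv_le_one_of_one_le₀ hR1) (act lam R v)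
    rw [act_act, ← Complex.ofReal_mul, inv_mul_cancel₀ hR.ne', Complex.ofReal_one, act_one,
      inv_mul_eq_div, le_div_iff₀ hR] at h
    refine le_trans ?_ h
    rw [← inv_le_iff_one_le_mul₀' (norm_pos_iff.2 hv)]
    exact le_max_right _ _
  have hcont : Continuous fun r : ℝ => ‖act lam r v‖ :=
    ((continuous_act lam).comp (Complex.continuous_ofReal.prodMk continuous_const)).norm
  obtain ⟨r, hr, hr1⟩ := intermediate_value_Icc hR.le hcont.continuousOn
    (show (1 : ℝ) ∈ Set.Icc _ _ from ⟨h0.trans_le zero_le_one, h1⟩)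
  refine ⟨r, hr.1.lt_of_ne ?_, hr1⟩
  rintro rfl
  exact zero_ne_one (h0.symm.trans hr1)

/-- A normalizing factor `r` with `‖act lam (r v) v‖ = 1` depends continuously on `v ≠ 0`. -/
lemma continuous_of_norm_act_eq_one (hlam : ∀ i, 0 < lam i)
    {r : {v : EuclideanSpace ℂ ι // v ≠ 0} → ℝ} (hpos : ∀ v, 0 < r v)
    (hr : ∀ v, ‖act lam (r v) v.1‖ = 1) : Continuous r := by
  have hcont (a : ℝ) :
      Continuous fun v : {v : EuclideanSpace ℂ ι // v ≠ 0} => ‖act lam a v.1‖ :=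
    ((continuous_act lam).comp (continuous_const.prodMk continuous_subtype_val)).norm
  have hlt {a : ℝ} (ha : 0 ≤ a) (v) : a < r v ↔ ‖act lam a v.1‖ < 1 := by
    rw [← (strictMonoOn_norm_act hlam v.2).lt_iff_lt ha (hpos v).le, hr]
  have hgt {a : ℝ} (ha : 0 ≤ a) (v) : r v < a ↔ 1 < ‖act lam a v.1‖ := by
    rw [← (strictMonoOn_norm_act hlam v.2).lt_iff_lt (hpos v).le ha, hr]
  rw [OrderTopology.continuous_iff]
  intro a
  rcases le_or_gt 0 a with ha | ha
  · constructor
    · simpa only [Set.preimage, Set.mem_Ioi, hlt ha] using isOpen_lt (hcont a) continuous_const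
    · simpa only [Set.preimage, Set.mem_Iio, hgt ha] using isOpen_lt continuous_const (hcont a)
  · constructor
    · convert isOpen_univ
      exact Set.eq_univ_of_forall fun v => ha.trans (hpos v)
    · convert isOpen_empty
      exact Set.eq_empty_of_forall_notMem fun v hv => lt_asymm hv (ha.trans (hpos v))

end WeightedHopf

/-- Let `λ₀, …, λₙ` be positive integers.  Let `ℂˣ` act on
`ℂ^{n+1} ∖ {0}` by the weighted Hopf action `z • (z₀, …, zₙ) = (z^{λ₀} z₀, …, z^{λₙ} zₙ)`,
and let the circle group `𝕊¹` act on the unit sphere `S^{2n+1} ⊆ ℂ^{n+1}` by the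
restriction of this action.  Then the inclusion `S^{2n+1} ↪ ℂ^{n+1} ∖ {0}` descends to a
homeomorphism of orbit spaces `S^{2n+1}/𝕊¹ ≅ (ℂ^{n+1} ∖ {0})/ℂˣ`, both equipped with
their quotient topologies (their common value is the underlying space of the weighted
projective space `ℂP^n[λ₀, …, λₙ]`). -/
theorem weightedHopf_sphere_quotient_homeomorph_punctured_quotient
    (n : ℕ) (lam : Fin (n + 1) → ℕ) (hlam : ∀ i, 0 < lam i) :
    ∃ h :
      Quot (fun v w : Metric.sphere (0 : EuclideanSpace ℂ (Fin (n + 1))) 1 =>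
          ∃ z : ℂ, ‖z‖ = 1 ∧ ∀ i : Fin (n + 1),
            (w : EuclideanSpace ℂ (Fin (n + 1))) i
              = z ^ lam i * (v : EuclideanSpace ℂ (Fin (n + 1))) i) ≃ₜ
      Quot (fun v w : {u : EuclideanSpace ℂ (Fin (n + 1)) // u ≠ 0} =>
          ∃ z : ℂ, z ≠ 0 ∧ ∀ i : Fin (n + 1),
            (w : EuclideanSpace ℂ (Fin (n + 1))) i
              = z ^ lam i * (v : EuclideanSpace ℂ (Fin (n + 1))) i),
      ∀ (v : EuclideanSpace ℂ (Fin (n + 1)))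
        (hv : v ∈ Metric.sphere (0 : EuclideanSpace ℂ (Fin (n + 1))) 1) (hv' : v ≠ 0),
        h (Quot.mk _ (⟨v, hv⟩ : Metric.sphere (0 : EuclideanSpace ℂ (Fin (n + 1))) 1))
          = Quot.mk _ (⟨v, hv'⟩ : {u : EuclideanSpace ℂ (Fin (n + 1)) // u ≠ 0}) := by
  choose r hpos hr using fun v : {u : EuclideanSpace ℂ (Fin (n + 1)) // u ≠ 0} =>
    WeightedHopf.exists_norm_act_eq_one hlam v.2
  have hr0 (v) : (r v : ℂ) ≠ 0 := Complex.ofReal_ne_zero.2 (hpos v).ne'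
  have hrc := WeightedHopf.continuous_of_norm_act_eq_one hlam hpos hr
  let inc : Metric.sphere (0 : EuclideanSpace ℂ (Fin (n + 1))) 1 →
      {u : EuclideanSpace ℂ (Fin (n + 1)) // u ≠ 0} :=
    fun v => ⟨v, ne_zero_of_mem_unit_sphere v⟩
  let ret : {u : EuclideanSpace ℂ (Fin (n + 1)) // u ≠ 0} →
      Metric.sphere (0 : EuclideanSpace ℂ (Fin (n + 1))) 1 :=
    fun v => ⟨WeightedHopf.act lam (r v) v, mem_sphere_zero_iff_norm.2 (hr v)⟩
  have hinc : Continuous inc := by fun_prop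
  have hret : Continuous ret :=
    ((WeightedHopf.continuous_act lam).comp
      ((Complex.continuous_ofReal.comp hrc).prodMk continuous_subtype_val)).subtype_mk _
  refine ⟨{
    toFun := Quot.map inc ?_
    invFun := Quot.map ret ?_
    left_inv := ?_
    right_inv := ?_
    continuous_toFun := continuous_quot_lift _ (continuous_quot_mk.comp hinc)
    continuous_invFun := continuous_quot_lift _ (continuous_quot_mk.comp hret) },
    fun v hv hv' => rfl⟩
  · rintro v w ⟨z, hz, h⟩
    exact ⟨z, norm_ne_zero_iff.1 (hz ▸ one_ne_zero), h⟩
  · rintro v w ⟨z, hz, h⟩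
    have hw : (w : EuclideanSpace ℂ (Fin (n + 1))) = WeightedHopf.act lam z v := by
      ext i
      exact h i
    have hact : (ret w : EuclideanSpace ℂ (Fin (n + 1))) =
        WeightedHopf.act lam (r w * z / r v) (ret v) := by
      change WeightedHopf.act lam (r w) w = WeightedHopf.act lam _ (WeightedHopf.act lam (r v) v)
      rw [hw, WeightedHopf.act_act, WeightedHopf.act_act, div_mul_cancel₀ _ (hr0 v)]
    refine ⟨_, WeightedHopf.norm_eq_one_of_norm_act hlam (hr v) ?_, fun i => congrArg (· i) hact⟩
    exact hact ▸ hr w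
  · rintro ⟨v⟩
    refine (Quot.sound ⟨(r (inc v) : ℂ), ?_, fun i => rfl⟩).symm
    exact WeightedHopf.norm_eq_one_of_norm_act hlam (mem_sphere_zero_iff_norm.1 v.2) (hr (inc v))
  · rintro ⟨v⟩
    exact (Quot.sound ⟨(r v : ℂ), hr0 v, fun i => rfl⟩).symm
end

section
/- Let λ₀, λ₁ be coprime positive integers and let the circle group 𝕊¹ = {z ∈ ℂ : |z| = 1} act on the unit sphere S³ = {(z₀,z₁) ∈ ℂ² : |z₀|² + |z₁|² = 1} by the weighted Hopf action z•(z₀,z₁) = (z^{λ₀}z₀, z^{λ₁}z₁). Then the orbit space S³/𝕊¹, equipped with the quotient topology, is homeomorphic to the 2-sphere S² = {v ∈ ℝ³ : ‖v‖ = 1} (the underlying space of the (λ₀,λ₁)-football orbifold ℂP¹[λ₀,λ₁]). -/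
open ComplexConjugate in
/-- The map `(a, b) ↦ (2 α conj β, |α|² - |β|²) / (|α|² + |β|²)` with `α = a ^ l1`, `β = b ^ l0`:
the classical Hopf map after raising the coordinates to complementary powers. -/
noncomputable def footballMap (l0 l1 : ℕ) (a b : ℂ) : EuclideanSpace ℝ (Fin 3) :=
  !₂[2 * (a ^ l1 * conj b ^ l0).re / ((‖a‖ ^ 2) ^ l1 + (‖b‖ ^ 2) ^ l0),
    2 * (a ^ l1 * conj b ^ l0).im / ((‖a‖ ^ 2) ^ l1 + (‖b‖ ^ 2) ^ l0),
    ((‖a‖ ^ 2) ^ l1 - (‖b‖ ^ 2) ^ l0) / ((‖a‖ ^ 2) ^ l1 + (‖b‖ ^ 2) ^ l0)]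

open ComplexConjugate in
lemma sq_re_add_sq_im_pow_mul_conj_pow (l0 l1 : ℕ) (a b : ℂ) :
    (a ^ l1 * conj b ^ l0).re ^ 2 + (a ^ l1 * conj b ^ l0).im ^ 2 =
      (‖a‖ ^ 2) ^ l1 * (‖b‖ ^ 2) ^ l0 := by
  have h := Complex.sq_norm (a ^ l1 * conj b ^ l0)
  rw [Complex.normSq_apply, norm_mul, norm_pow, norm_pow, RCLike.norm_conj] at h
  linear_combination -h

lemma sq_norm_pow_add_sq_norm_pow_pos (l0 l1 : ℕ) {a b : ℂ} (h : ‖a‖ ^ 2 + ‖b‖ ^ 2 = 1) :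
    0 < (‖a‖ ^ 2) ^ l1 + (‖b‖ ^ 2) ^ l0 := by
  rcases (sq_nonneg ‖a‖).eq_or_lt with ha | ha
  · have hb : ‖b‖ ^ 2 = 1 := by linarith
    rw [hb, one_pow]
    positivity
  · positivity

lemma footballMap_mem_sphere (l0 l1 : ℕ) {a b : ℂ} (h : ‖a‖ ^ 2 + ‖b‖ ^ 2 = 1) :
    footballMap l0 l1 a b ∈ Metric.sphere (0 : EuclideanSpace ℝ (Fin 3)) 1 := by
  have hN := (sq_norm_pow_add_sq_norm_pow_pos l0 l1 h).ne'
  have hw := sq_re_add_sq_im_pow_mul_conj_pow l0 l1 a b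
  rw [mem_sphere_zero_iff_norm, EuclideanSpace.norm_eq, Real.sqrt_eq_one]
  simp only [footballMap, Fin.sum_univ_three, Real.norm_eq_abs, sq_abs, PiLp.toLp_apply,
    Matrix.cons_val]
  field_simp
  linear_combination 4 * hw

lemma footballMap_smul (l0 l1 : ℕ) {z : ℂ} (hz : ‖z‖ = 1) (a b : ℂ) :
    footballMap l0 l1 (z ^ l0 * a) (z ^ l1 * b) = footballMap l0 l1 a b := by
  have hzz : z * (starRingEnd ℂ) z = 1 := by
    rw [Complex.mul_conj, Complex.normSq_eq_norm_sq, hz]; simp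
  have hw : (z ^ l0 * a) ^ l1 * (starRingEnd ℂ) (z ^ l1 * b) ^ l0 =
      a ^ l1 * (starRingEnd ℂ) b ^ l0 := by
    calc _ = (z * (starRingEnd ℂ) z) ^ (l0 * l1) * (a ^ l1 * (starRingEnd ℂ) b ^ l0) := by
          simp only [map_mul, map_pow]; ring
      _ = _ := by rw [hzz]; simp
  simp only [footballMap, hw, norm_mul, norm_pow, hz, one_pow, one_mul]

lemma exists_norm_eq_one_pow_eq {n : ℕ} (hn : 0 < n) {c : ℂ} (hc : ‖c‖ = 1) :
    ∃ z : ℂ, ‖z‖ = 1 ∧ z ^ n = c := by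
  obtain ⟨z, hz⟩ := IsAlgClosed.exists_pow_nat_eq c hn
  refine ⟨z, ?_, hz⟩
  rw [← pow_eq_one_iff_of_nonneg (norm_nonneg z) hn.ne', ← norm_pow, hz, hc]

lemma exists_common_root {l0 l1 : ℕ} (hco : Nat.Coprime l0 l1) {p q : ℂ}
    (hp : ‖p‖ = 1) (hq : ‖q‖ = 1) (hpq : p ^ l1 = q ^ l0) :
    ∃ z : ℂ, ‖z‖ = 1 ∧ z ^ l0 = p ∧ z ^ l1 = q := by
  have hp0 : p ≠ 0 := by rintro rfl; simp at hp
  have hq0 : q ≠ 0 := by rintro rfl; simp at hq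
  have hb : (l0 : ℤ) * l0.gcdA l1 + l1 * l0.gcdB l1 = 1 := by
    rw [← Nat.gcd_eq_gcd_ab, hco.gcd_eq_one]; rfl
  set u := l0.gcdA l1
  set v := l0.gcdB l1
  have hpq' : p ^ (l1 : ℤ) = q ^ (l0 : ℤ) := by exact_mod_cast hpq
  refine ⟨p ^ u * q ^ v, by simp [hp, hq], ?_, ?_⟩
  · calc (p ^ u * q ^ v) ^ l0 = (p ^ (l0 : ℤ)) ^ u * (q ^ (l0 : ℤ)) ^ v := by
          rw [mul_pow, ← zpow_natCast, ← zpow_natCast, ← zpow_mul, ← zpow_mul, ← zpow_mul,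
            ← zpow_mul, mul_comm u, mul_comm v]
      _ = p ^ ((l0 : ℤ) * u + l1 * v) := by
          rw [← hpq', ← zpow_mul, ← zpow_mul, ← zpow_add₀ hp0]
      _ = p := by rw [hb, zpow_one]
  · calc (p ^ u * q ^ v) ^ l1 = (p ^ (l1 : ℤ)) ^ u * (q ^ (l1 : ℤ)) ^ v := by
          rw [mul_pow, ← zpow_natCast, ← zpow_natCast, ← zpow_mul, ← zpow_mul, ← zpow_mul,
            ← zpow_mul, mul_comm u, mul_comm v]
      _ = q ^ ((l0 : ℤ) * u + l1 * v) := by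
          rw [hpq', ← zpow_mul, ← zpow_mul, ← zpow_add₀ hq0]
      _ = q := by rw [hb, zpow_one]

/-- On the segment `x + y = 1`, the point `[x ^ n : y ^ m]` determines `x` and `y`. -/
lemma eq_of_pow_div_eq {n m : ℕ} (hn : 0 < n) (hm : 0 < m) {x y x' y' : ℝ}
    (hx' : 0 ≤ x') (hy' : 0 ≤ y') (h : x + y = 1) (h' : x' + y' = 1)
    (hN : 0 < x ^ n + y ^ m) (hN' : 0 < x' ^ n + y' ^ m)
    (hxx : x ^ n / (x ^ n + y ^ m) = x' ^ n / (x' ^ n + y' ^ m))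
    (hyy : y ^ m / (x ^ n + y ^ m) = y' ^ m / (x' ^ n + y' ^ m))
    (hle : x ^ n + y ^ m ≤ x' ^ n + y' ^ m) : x = x' ∧ y = y' := by
  rw [div_eq_div_iff hN.ne' hN'.ne'] at hxx hyy
  have h1 : x ≤ x' := by
    refine le_of_pow_le_pow_left₀ hn.ne' hx' (le_of_mul_le_mul_right ?_ hN')
    rw [hxx]; gcongr
  have h2 : y ≤ y' := by
    refine le_of_pow_le_pow_left₀ hm.ne' hy' (le_of_mul_le_mul_right ?_ hN')
    rw [hyy]; gcongr
  constructor <;> linarith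

lemma norm_eq_of_footballMap_eq {l0 l1 : ℕ} (h0 : 0 < l0) (h1 : 0 < l1) {a b a' b' : ℂ}
    (h : ‖a‖ ^ 2 + ‖b‖ ^ 2 = 1) (h' : ‖a'‖ ^ 2 + ‖b'‖ ^ 2 = 1)
    (hf : footballMap l0 l1 a b = footballMap l0 l1 a' b') : ‖a‖ = ‖a'‖ ∧ ‖b‖ = ‖b'‖ := by
  have hN := sq_norm_pow_add_sq_norm_pow_pos l0 l1 h
  have hN' := sq_norm_pow_add_sq_norm_pow_pos l0 l1 h'
  have hc : ((‖a‖ ^ 2) ^ l1 - (‖b‖ ^ 2) ^ l0) / ((‖a‖ ^ 2) ^ l1 + (‖b‖ ^ 2) ^ l0) =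
      ((‖a'‖ ^ 2) ^ l1 - (‖b'‖ ^ 2) ^ l0) / ((‖a'‖ ^ 2) ^ l1 + (‖b'‖ ^ 2) ^ l0) :=
    congrArg (fun v : EuclideanSpace ℝ (Fin 3) => v 2) hf
  rw [div_eq_div_iff hN.ne' hN'.ne'] at hc
  have hxx : (‖a‖ ^ 2) ^ l1 / ((‖a‖ ^ 2) ^ l1 + (‖b‖ ^ 2) ^ l0) =
      (‖a'‖ ^ 2) ^ l1 / ((‖a'‖ ^ 2) ^ l1 + (‖b'‖ ^ 2) ^ l0) := by
    rw [div_eq_div_iff hN.ne' hN'.ne']; linarith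
  have hyy : (‖b‖ ^ 2) ^ l0 / ((‖a‖ ^ 2) ^ l1 + (‖b‖ ^ 2) ^ l0) =
      (‖b'‖ ^ 2) ^ l0 / ((‖a'‖ ^ 2) ^ l1 + (‖b'‖ ^ 2) ^ l0) := by
    rw [div_eq_div_iff hN.ne' hN'.ne']; linarith
  suffices H : ‖a‖ ^ 2 = ‖a'‖ ^ 2 ∧ ‖b‖ ^ 2 = ‖b'‖ ^ 2 from
    ⟨(sq_eq_sq₀ (norm_nonneg _) (norm_nonneg _)).1 H.1,
      (sq_eq_sq₀ (norm_nonneg _) (norm_nonneg _)).1 H.2⟩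
  rcases le_total ((‖a‖ ^ 2) ^ l1 + (‖b‖ ^ 2) ^ l0)
    ((‖a'‖ ^ 2) ^ l1 + (‖b'‖ ^ 2) ^ l0) with hle | hle
  · exact eq_of_pow_div_eq h1 h0 (sq_nonneg _) (sq_nonneg _) h h' hN hN' hxx hyy hle
  · have H := eq_of_pow_div_eq h1 h0 (sq_nonneg _) (sq_nonneg _) h' h hN' hN hxx.symm hyy.symm hle
    exact ⟨H.1.symm, H.2.symm⟩

lemma exists_smul_eq_of_footballMap_eq {l0 l1 : ℕ} (h0 : 0 < l0) (h1 : 0 < l1)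
    (hco : Nat.Coprime l0 l1) {a b a' b' : ℂ}
    (h : ‖a‖ ^ 2 + ‖b‖ ^ 2 = 1) (h' : ‖a'‖ ^ 2 + ‖b'‖ ^ 2 = 1)
    (hf : footballMap l0 l1 a b = footballMap l0 l1 a' b') :
    ∃ z : ℂ, ‖z‖ = 1 ∧ a' = z ^ l0 * a ∧ b' = z ^ l1 * b := by
  obtain ⟨ha, hb⟩ := norm_eq_of_footballMap_eq h0 h1 h h' hf
  by_cases ha0 : a = 0
  · obtain rfl : a' = 0 := by rw [← norm_eq_zero, ← ha, ha0, norm_zero]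
    have hb0 : b ≠ 0 := by rintro rfl; simp [ha0] at h
    obtain ⟨z, hz, hzb⟩ := exists_norm_eq_one_pow_eq (c := b' / b) h1
      (by rw [norm_div, ← hb, div_self (norm_ne_zero_iff.2 hb0)])
    exact ⟨z, hz, by simp [ha0], by rw [hzb, div_mul_cancel₀ _ hb0]⟩
  by_cases hb0 : b = 0
  · obtain rfl : b' = 0 := by rw [← norm_eq_zero, ← hb, hb0, norm_zero]
    obtain ⟨z, hz, hza⟩ := exists_norm_eq_one_pow_eq (c := a' / a) h0
      (by rw [norm_div, ← ha, div_self (norm_ne_zero_iff.2 ha0)])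
    exact ⟨z, hz, by rw [hza, div_mul_cancel₀ _ ha0], by simp [hb0]⟩
  have hN := (sq_norm_pow_add_sq_norm_pow_pos l0 l1 h).ne'
  have hw : a ^ l1 * (starRingEnd ℂ) b ^ l0 = a' ^ l1 * (starRingEnd ℂ) b' ^ l0 := by
    have hre := congrArg (fun v : EuclideanSpace ℝ (Fin 3) => v 0) hf
    have him := congrArg (fun v : EuclideanSpace ℝ (Fin 3) => v 1) hf
    simp only [footballMap, PiLp.toLp_apply, Matrix.cons_val, ← ha, ← hb] at hre him
    rw [div_left_inj' hN] at hre him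
    apply Complex.ext <;> linarith
  have hconj (c : ℂ) : (starRingEnd ℂ) c * c = ((‖c‖ ^ 2 : ℝ) : ℂ) := by
    rw [mul_comm, Complex.mul_conj, Complex.normSq_eq_norm_sq]
  have hcross : a' ^ l1 * b ^ l0 = b' ^ l0 * a ^ l1 := by
    have hb2 : (((‖b‖ ^ 2 : ℝ) : ℂ)) ^ l0 ≠ 0 := by
      have := norm_ne_zero_iff.2 hb0
      exact pow_ne_zero _ (by exact_mod_cast pow_ne_zero 2 this)
    apply mul_right_cancel₀ hb2
    calc a' ^ l1 * b ^ l0 * ((‖b‖ ^ 2 : ℝ) : ℂ) ^ l0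
        = (a' ^ l1 * (starRingEnd ℂ) b' ^ l0) * b' ^ l0 * b ^ l0 := by
          rw [hb, ← hconj b', mul_pow]; ring
      _ = b' ^ l0 * a ^ l1 * ((‖b‖ ^ 2 : ℝ) : ℂ) ^ l0 := by
          rw [← hw, ← hconj b, mul_pow]; ring
  obtain ⟨z, hz, hza, hzb⟩ := exists_common_root (p := a' / a) (q := b' / b) hco
    (by rw [norm_div, ← ha, div_self (norm_ne_zero_iff.2 ha0)])
    (by rw [norm_div, ← hb, div_self (norm_ne_zero_iff.2 hb0)])
    (by rw [div_pow, div_pow, div_eq_div_iff (pow_ne_zero _ ha0) (pow_ne_zero _ hb0), hcross])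
  exact ⟨z, hz, by rw [hza, div_mul_cancel₀ _ ha0], by rw [hzb, div_mul_cancel₀ _ hb0]⟩

lemma exists_one_sub_mul_pow_eq_mul_pow {n m : ℕ} (hn : 0 < n) (hm : 0 < m) {s : ℝ} (hs0 : 0 ≤ s)
    (hs1 : s ≤ 1) : ∃ x ∈ Set.Icc (0 : ℝ) 1, (1 - s) * x ^ n = s * (1 - x) ^ m := by
  have hc : ContinuousOn (fun x : ℝ => (1 - s) * x ^ n - s * (1 - x) ^ m) (Set.Icc 0 1) := by
    fun_prop
  obtain ⟨x, hx, hx0⟩ := intermediate_value_Icc zero_le_one hc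
    (show (0 : ℝ) ∈ _ by simp [hn.ne', hm.ne', hs0, hs1])
  exact ⟨x, hx, sub_eq_zero.1 hx0⟩

lemma exists_footballMap_eq {l0 l1 : ℕ} (h0 : 0 < l0) (h1 : 0 < l1)
    {y : EuclideanSpace ℝ (Fin 3)} (hy : ‖y‖ = 1) :
    ∃ a b : ℂ, ‖a‖ ^ 2 + ‖b‖ ^ 2 = 1 ∧ footballMap l0 l1 a b = y := by
  have hsum : y 0 ^ 2 + y 1 ^ 2 + y 2 ^ 2 = 1 := by
    rw [EuclideanSpace.norm_eq, Real.sqrt_eq_one] at hy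
    simpa [Fin.sum_univ_three] using hy
  set w : ℂ := ⟨y 0, y 1⟩ with hwdef
  have hw : ‖w‖ ^ 2 = y 0 ^ 2 + y 1 ^ 2 := by
    rw [Complex.sq_norm, Complex.normSq_apply]; ring
  obtain ⟨x, ⟨hx0, hx1⟩, hx⟩ := exists_one_sub_mul_pow_eq_mul_pow h1 h0 (s := (1 + y 2) / 2)
    (by nlinarith [sq_nonneg (y 0), sq_nonneg (y 1)])
    (by nlinarith [sq_nonneg (y 0), sq_nonneg (y 1)])
  obtain ⟨e, he, hew⟩ : ∃ e : ℂ, ‖e‖ = 1 ∧ e ^ l1 * ‖w‖ = w := by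
    by_cases hw0 : w = 0
    · exact ⟨1, by simp, by simp [hw0]⟩
    · have hn := norm_ne_zero_iff.2 hw0
      obtain ⟨e, he, hew⟩ := exists_norm_eq_one_pow_eq (c := w / ‖w‖) h1 (by simp [hn])
      exact ⟨e, he, by rw [hew, div_mul_cancel₀ _ (by exact_mod_cast hn)]⟩
  have hna : ‖(√x : ℂ) * e‖ ^ 2 = x := by
    rw [norm_mul, he, Complex.norm_real, mul_one, Real.norm_eq_abs, sq_abs, Real.sq_sqrt hx0]
  have hnb : ‖(√(1 - x) : ℂ)‖ ^ 2 = 1 - x := by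
    rw [Complex.norm_real, Real.norm_eq_abs, sq_abs, Real.sq_sqrt (by linarith)]
  have hab : ‖(√x : ℂ) * e‖ ^ 2 + ‖(√(1 - x) : ℂ)‖ ^ 2 = 1 := by rw [hna, hnb]; ring
  refine ⟨_, _, hab, ?_⟩
  have hN := sq_norm_pow_add_sq_norm_pow_pos l0 l1 hab
  rw [hna, hnb] at hN
  have hr : √x ^ l1 * √(1 - x) ^ l0 = (x ^ l1 + (1 - x) ^ l0) / 2 * ‖w‖ := by
    rw [← sq_eq_sq₀ (by positivity) (by positivity), mul_pow, mul_pow, ← pow_mul, ← pow_mul,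
      mul_comm l1, mul_comm l0, pow_mul, pow_mul, Real.sq_sqrt hx0, Real.sq_sqrt (by linarith),
      hw, show y 0 ^ 2 + y 1 ^ 2 = 1 - y 2 ^ 2 by linarith]
    generalize x ^ l1 = p at *
    generalize (1 - x) ^ l0 = q at *
    have hpq : p - q = y 2 * (p + q) := by linarith
    linear_combination (-1 / 4) * (p - q + y 2 * (p + q)) * hpq
  have hprod : ((√x : ℂ) * e) ^ l1 * (starRingEnd ℂ) (√(1 - x) : ℂ) ^ l0 =
      (((x ^ l1 + (1 - x) ^ l0) / 2 : ℝ) : ℂ) * w := by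
    calc _ = ((√x ^ l1 * √(1 - x) ^ l0 : ℝ) : ℂ) * e ^ l1 := by
          rw [Complex.conj_ofReal]; push_cast; ring
      _ = (((x ^ l1 + (1 - x) ^ l0) / 2 : ℝ) : ℂ) * (e ^ l1 * ‖w‖) := by
          rw [hr, Complex.ofReal_mul]; ring
      _ = _ := by rw [hew]
  ext i
  fin_cases i
  all_goals
    simp only [footballMap, hprod, hna, hnb, Complex.re_ofReal_mul, Complex.im_ofReal_mul, hwdef]
    simp
    rw [div_eq_iff hN.ne']
    linarith

lemma sq_norm_add_sq_norm_eq_one (v : Metric.sphere (0 : EuclideanSpace ℂ (Fin 2)) 1) :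
    ‖(v : EuclideanSpace ℂ (Fin 2)) 0‖ ^ 2 + ‖(v : EuclideanSpace ℂ (Fin 2)) 1‖ ^ 2 = 1 := by
  have h := norm_eq_of_mem_sphere v
  rwa [EuclideanSpace.norm_eq, Real.sqrt_eq_one, Fin.sum_univ_two] at h

/-- `footballMap` as a map of spheres. -/
noncomputable def footballSphereMap (l0 l1 : ℕ)
    (v : Metric.sphere (0 : EuclideanSpace ℂ (Fin 2)) 1) :
    Metric.sphere (0 : EuclideanSpace ℝ (Fin 3)) 1 :=
  ⟨footballMap l0 l1 ((v : EuclideanSpace ℂ (Fin 2)) 0) ((v : EuclideanSpace ℂ (Fin 2)) 1),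
    footballMap_mem_sphere l0 l1 (sq_norm_add_sq_norm_eq_one v)⟩

lemma continuous_footballSphereMap (l0 l1 : ℕ) : Continuous (footballSphereMap l0 l1) := by
  have hN (v : Metric.sphere (0 : EuclideanSpace ℂ (Fin 2)) 1) :=
    (sq_norm_pow_add_sq_norm_pow_pos l0 l1 (sq_norm_add_sq_norm_eq_one v)).ne'
  refine Continuous.subtype_mk ((PiLp.continuous_toLp 2 _).comp (continuous_pi fun i => ?_)) _
  fin_cases i
  all_goals
    refine Continuous.div ?_ ?_ hN
    all_goals fun_prop


/-- Let `λ₀, λ₁` be coprime positive integers and let the circle group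
`𝕊¹` act on the unit sphere `S³ = {(z₀, z₁) ∈ ℂ² : |z₀|² + |z₁|² = 1}` by the weighted
Hopf action `z • (z₀, z₁) = (z^{λ₀} z₀, z^{λ₁} z₁)`.  Then the orbit space `S³/𝕊¹`, with
the quotient topology, is homeomorphic to the 2-sphere `S² = {v ∈ ℝ³ : ‖v‖ = 1}` — the
underlying space of the `(λ₀, λ₁)`-football orbifold `ℂP¹[λ₀, λ₁]`. -/
theorem weightedHopf_quotient_homeomorph_sphere
    (l0 l1 : ℕ) (h0 : 0 < l0) (h1 : 0 < l1) (hco : Nat.Coprime l0 l1) :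
    Nonempty
      (Quot (fun v w : Metric.sphere (0 : EuclideanSpace ℂ (Fin 2)) 1 =>
          ∃ z : ℂ, ‖z‖ = 1 ∧
            (w : EuclideanSpace ℂ (Fin 2)) 0 = z ^ l0 * (v : EuclideanSpace ℂ (Fin 2)) 0 ∧
            (w : EuclideanSpace ℂ (Fin 2)) 1 = z ^ l1 * (v : EuclideanSpace ℂ (Fin 2)) 1) ≃ₜ
        Metric.sphere (0 : EuclideanSpace ℝ (Fin 3)) 1) := by
  let f := Quot.lift (footballSphereMap l0 l1)
      (r := fun v w : Metric.sphere (0 : EuclideanSpace ℂ (Fin 2)) 1 =>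
      ∃ z : ℂ, ‖z‖ = 1 ∧
        (w : EuclideanSpace ℂ (Fin 2)) 0 = z ^ l0 * (v : EuclideanSpace ℂ (Fin 2)) 0 ∧
        (w : EuclideanSpace ℂ (Fin 2)) 1 = z ^ l1 * (v : EuclideanSpace ℂ (Fin 2)) 1) (by
    rintro v w ⟨z, hz, hv, hw⟩
    refine Subtype.ext (Eq.symm ?_)
    change footballMap l0 l1 _ _ = footballMap l0 l1 _ _
    rw [hv, hw, footballMap_smul l0 l1 hz])
  have hf : Continuous f := continuous_quot_lift _ (continuous_footballSphereMap l0 l1)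
  have hbij : Function.Bijective f := by
    constructor
    · rintro ⟨v⟩ ⟨w⟩ h
      exact Quot.sound (exists_smul_eq_of_footballMap_eq h0 h1 hco
        (sq_norm_add_sq_norm_eq_one v) (sq_norm_add_sq_norm_eq_one w) (congrArg Subtype.val h))
    · rintro ⟨y, hy⟩
      obtain ⟨a, b, hab, rfl⟩ := exists_footballMap_eq h0 h1 (mem_sphere_zero_iff_norm.1 hy)
      refine ⟨Quot.mk _ ⟨!₂[a, b], ?_⟩, rfl⟩
      rw [mem_sphere_zero_iff_norm, EuclideanSpace.norm_eq, Real.sqrt_eq_one, Fin.sum_univ_two]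
      exact hab
  exact ⟨Continuous.homeoOfEquivCompactToT2 (f := Equiv.ofBijective f hbij) hf⟩
end
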